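/- arXiv:2604.12072 — 8 statements merged into one kernel-verified Lean document; each statement's English description precedes it below -/
import Mathlib

section
/- Let V be an n-dimensional complex vector space equipped with a (possibly degenerate) quadratic form Q, and let U ⊆ V be a totally isotropic subspace of dimension k. Then the quotient of the Clifford algebra Cl(Q) by the ℂ-linear span of { ι(u)·y : u ∈ U, y ∈ Cl(Q) } has ℂ-dimension 2^(n−k); equivalently, the span of { ι(u)·y : u ∈ U, y ∈ Cl(Q) } has ℂ-dimension (2^k − 1)·2^(n−k). -/
open CliffordAlgebra


theorem finrank_exterior_aux {W : Type*} [AddCommGroup W] [Module ℂ W] [FiniteDimensional ℂ W] :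
    Module.finrank ℂ (ExteriorAlgebra ℂ W) = 2 ^ Module.finrank ℂ W := by
  rw [Module.finrank_eq_card_basis (Module.finBasis ℂ W).ExteriorAlgebra]
  simp

theorem finite_exterior_aux {W : Type*} [AddCommGroup W] [Module ℂ W] [FiniteDimensional ℂ W] :
    FiniteDimensional ℂ (ExteriorAlgebra ℂ W) :=
  Module.Finite.of_basis (Module.finBasis ℂ W).ExteriorAlgebra

theorem exists_bilin_aux {V : Type*} [AddCommGroup V] [Module ℂ V]
    (Q : QuadraticForm ℂ V) (U : Submodule ℂ V) (hU : ∀ u ∈ U, Q u = 0)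
    (p : V →ₗ[ℂ] V) (hp : ∀ u ∈ U, p u = 0) (hp' : ∀ x, x - p x ∈ U) :
    ∃ B : LinearMap.BilinForm ℂ V, B.toQuadraticMap = 0 - Q ∧ ∀ u ∈ U, B u = 0 := by
  refine ⟨-((QuadraticMap.polarBilin Q).comp p
    - (1 / 2 : ℂ) • (QuadraticMap.polarBilin Q).compl₁₂ p p), ?_, ?_⟩
  · ext x
    have h1 := hU _ (hp' x)
    have h2 : QuadraticMap.polar Q (p x) x
        = QuadraticMap.polar Q (p x) (p x) + QuadraticMap.polar Q (p x) (x - p x) := by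
      rw [← QuadraticMap.polar_add_right]
      congr 1
      abel
    have h3 : QuadraticMap.polar Q (p x) (x - p x) = Q x - Q (p x) := by
      rw [QuadraticMap.polar, h1, add_sub_cancel, sub_zero]
    have h4 : QuadraticMap.polar Q (p x) (p x) = 2 * Q (p x) := by
      rw [QuadraticMap.polar_self]; simp
    simp [h2, h3, h4]
    ring
  · intro u hu
    ext y
    simp [hp u hu]

theorem ker_aux {V : Type*} [AddCommGroup V] [Module ℂ V]
    (Q : QuadraticForm ℂ V) (U : Submodule ℂ V) (hU : ∀ u ∈ U, Q u = 0) :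
    ∃ f : CliffordAlgebra Q →ₗ[ℂ] ExteriorAlgebra ℂ (V ⧸ U), Function.Surjective f ∧
      LinearMap.ker f = Submodule.span ℂ
          {z : CliffordAlgebra Q | ∃ u ∈ U, ∃ y : CliffordAlgebra Q, z = ι Q u * y} := by
  obtain ⟨s, hs⟩ := U.mkQ.exists_rightInverse_of_surjective U.range_mkQ
  have hs' : ∀ w, U.mkQ (s w) = w := fun w => LinearMap.congr_fun hs w
  obtain ⟨B, hB, hBU⟩ := exists_bilin_aux Q U hU (s ∘ₗ U.mkQ)
    (fun u hu => by
      have : U.mkQ u = 0 := by simpa using hu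
      rw [LinearMap.comp_apply, this, map_zero])
    (fun x => by
      refine (Submodule.Quotient.mk_eq_zero U).1 ?_
      rw [← Submodule.mkQ_apply, map_sub, LinearMap.comp_apply, hs', sub_self])
  set I := Submodule.span ℂ
    {z : CliffordAlgebra Q | ∃ u ∈ U, ∃ y : CliffordAlgebra Q, z = ι Q u * y} with hI
  let e : CliffordAlgebra Q ≃ₗ[ℂ] ExteriorAlgebra ℂ V := changeFormEquiv hB
  have he : ∀ u ∈ U, ∀ y, e (ι Q u * y) = ExteriorAlgebra.ι ℂ u * e y := by
    intro u hu y
    have := changeForm_ι_mul hB u y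
    rw [hBU u hu, map_zero, LinearMap.zero_apply, sub_zero] at this
    exact this
  let q := ExteriorAlgebra.map U.mkQ
  let t := ExteriorAlgebra.map s
  have hqt : ∀ w, q (t w) = w := by
    intro w
    have := ExteriorAlgebra.map_comp_map s U.mkQ
    rw [hs, ExteriorAlgebra.map_id] at this
    exact DFunLike.congr_fun this w
  let J := I.map e.toLinearMap
  have hJ1 : ∀ u ∈ U, ∀ y, ExteriorAlgebra.ι ℂ u * y ∈ J := by
    intro u hu y
    refine ⟨ι Q u * e.symm y, Submodule.subset_span ⟨u, hu, _, rfl⟩, ?_⟩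
    simpa using he u hu (e.symm y)
  have hJ2 : ∀ v, ∀ x ∈ J, ExteriorAlgebra.ι ℂ v * x ∈ J := by
    rintro v _ ⟨x, hx, rfl⟩
    refine Submodule.span_induction (p := fun x _ => ExteriorAlgebra.ι ℂ v * e x ∈ J)
      ?_ ?_ ?_ ?_ hx
    · rintro _ ⟨u, hu, y, rfl⟩
      rw [he u hu, ← mul_assoc, eq_neg_of_add_eq_zero_left (ExteriorAlgebra.ι_add_mul_swap v u),
        neg_mul, mul_assoc]
      exact J.neg_mem (hJ1 u hu _)
    · simp
    · intro a b _ _ ha hb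
      rw [map_add, mul_add]
      exact J.add_mem ha hb
    · intro c a _ ha
      rw [map_smul, mul_smul_comm]
      exact J.smul_mem c ha
  have key : ∀ x, t (q x) - x ∈ J := by
    intro x
    induction x using CliffordAlgebra.left_induction with
    | algebraMap r => simp [AlgHom.commutes]
    | add x y hx hy =>
      have : t (q (x + y)) - (x + y) = (t (q x) - x) + (t (q y) - y) := by
        rw [map_add, map_add]; abel
      rw [this]
      exact J.add_mem hx hy
    | ι_mul x m hx =>
      change t (q (ExteriorAlgebra.ι ℂ m * x)) - ExteriorAlgebra.ι ℂ m * x ∈ J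
      have h1 : t (q (ExteriorAlgebra.ι ℂ m)) = ExteriorAlgebra.ι ℂ (s (U.mkQ m)) := by
        simp only [q, t, ExteriorAlgebra.map_apply_ι]
      have : t (q (ExteriorAlgebra.ι ℂ m * x)) - ExteriorAlgebra.ι ℂ m * x
          = ExteriorAlgebra.ι ℂ (s (U.mkQ m) - m) * t (q x)
            + ExteriorAlgebra.ι ℂ m * (t (q x) - x) := by
        rw [map_mul, map_mul, h1, map_sub, sub_mul, mul_sub]; abel
      rw [this]
      refine J.add_mem (hJ1 _ ?_ _) (hJ2 _ _ hx)
      refine (Submodule.Quotient.mk_eq_zero U).1 ?_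
      rw [← Submodule.mkQ_apply, map_sub, hs', sub_self]
  refine ⟨q.toLinearMap ∘ₗ e.toLinearMap, ?_, ?_⟩
  · intro w
    exact ⟨e.symm (t w), by simp [hqt]⟩
  · apply le_antisymm
    · intro x hx
      have hx' : q (e x) = 0 := hx
      have := key (e x)
      rw [hx', map_zero, zero_sub, J.neg_mem_iff] at this
      obtain ⟨y, hy, hyx⟩ := this
      rwa [← e.injective hyx]
    · rw [hI, Submodule.span_le]
      rintro _ ⟨u, hu, y, rfl⟩
      have h0 : U.mkQ u = 0 := by simpa using hu
      change q (e (ι Q u * y)) = 0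
      rw [he u hu, map_mul, ExteriorAlgebra.map_apply_ι, h0, map_zero, zero_mul]

/-- For an `n`-dimensional quadratic space `(V, Q)` and a `k`-dimensional totally isotropic
subspace `U`, the quotient of `Cl(Q)` by the span of `{ι(u)·y : u ∈ U, y ∈ Cl(Q)}` has
dimension `2^(n-k)`; equivalently, that span has dimension `(2^k - 1)·2^(n-k)`. -/
theorem finrank_cliffordAlgebra_quotient_isotropic_span
    {V : Type*} [AddCommGroup V] [Module ℂ V] [FiniteDimensional ℂ V]
    (Q : QuadraticForm ℂ V) (n : ℕ) (hn : Module.finrank ℂ V = n)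
    (U : Submodule ℂ V) (hU : ∀ u ∈ U, Q u = 0)
    (k : ℕ) (hk : Module.finrank ℂ U = k) :
    Module.finrank ℂ
        (CliffordAlgebra Q ⧸ Submodule.span ℂ
          {z : CliffordAlgebra Q | ∃ u ∈ U, ∃ y : CliffordAlgebra Q, z = ι Q u * y})
      = 2 ^ (n - k) ∧
    Module.finrank ℂ
        (Submodule.span ℂ
          {z : CliffordAlgebra Q | ∃ u ∈ U, ∃ y : CliffordAlgebra Q, z = ι Q u * y})
      = (2 ^ k - 1) * 2 ^ (n - k) := by
  have hfin : FiniteDimensional ℂ (CliffordAlgebra Q) :=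
    have := finite_exterior_aux (W := V)
    Module.Finite.equiv (equivExterior Q).symm
  have hdim : Module.finrank ℂ (CliffordAlgebra Q) = 2 ^ n := by
    rw [(equivExterior Q).finrank_eq, finrank_exterior_aux, hn]
  have hnk := U.finrank_quotient_add_finrank
  rw [hn, hk] at hnk
  obtain ⟨f, hf, hker⟩ := ker_aux Q U hU
  rw [← hker]
  have h1 : Module.finrank ℂ (CliffordAlgebra Q ⧸ LinearMap.ker f) = 2 ^ (n - k) := by
    rw [(f.quotKerEquivOfSurjective hf).finrank_eq, finrank_exterior_aux]
    congr 1
    omega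
  refine ⟨h1, ?_⟩
  have h2 := (LinearMap.ker f).finrank_quotient_add_finrank
  rw [h1, hdim] at h2
  have h3 : 2 ^ n = 2 ^ k * 2 ^ (n - k) := by
    rw [← pow_add]
    congr 1
    omega
  rw [Nat.sub_mul, ← h3, one_mul]
  omega
end

section
/- Let V be an n-dimensional complex vector space equipped with a (possibly degenerate) quadratic form Q, and let U ⊆ V be a totally isotropic subspace of dimension k with k < n. Let Cl¹(Q) ⊆ Cl(Q) denote the odd part of the ℤ/2-grading of the Clifford algebra. Then the ℂ-linear span of { ι(u)·y : u ∈ U, y ∈ Cl¹(Q) } inside the even part Cl⁰(Q) has ℂ-dimension (2^k − 1)·2^(n−k−1). In particular this dimension depends only on n and k and not on Q or on the choice of totally isotropic U. -/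
open CliffordAlgebra

namespace IsoSpan

variable {V : Type*} [AddCommGroup V] [Module ℂ V]

theorem parity_induction {Q : QuadraticForm ℂ V} {P : ZMod 2 → CliffordAlgebra Q → Prop}
    (alg : ∀ r : ℂ, P 0 (algebraMap _ _ r))
    (add : ∀ i x y, P i x → P i y → P i (x + y))
    (mul : ∀ i m x, x ∈ evenOdd Q i → P i x → P (i + 1) (ι Q m * x))
    (i : ZMod 2) (x : CliffordAlgebra Q) (hx : x ∈ evenOdd Q i) : P i x := by
  have two : ∀ (i : ZMod 2) m₁ m₂ (x : CliffordAlgebra Q), x ∈ evenOdd Q i → P i x →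
      P i (ι Q m₁ * ι Q m₂ * x) := by
    intro i m₁ m₂ x hx h
    have h1 := mul (i + 1) m₁ _ (by
      rw [add_comm]
      exact SetLike.mul_mem_graded (ι_mem_evenOdd_one Q m₂) hx) (mul i m₂ x hx h)
    have e : i + 1 + 1 = i := (by decide : ∀ i : ZMod 2, i + 1 + 1 = i) i
    rwa [e, ← mul_assoc] at h1
  have hi : i = 0 ∨ i = 1 := (by decide : ∀ i : ZMod 2, i = 0 ∨ i = 1) i
  rcases hi with rfl | rfl
  · induction x, hx using even_induction with
    | algebraMap r => exact alg r
    | add x y hx hy h1 h2 => exact add _ _ _ h1 h2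
    | ι_mul_ι_mul m₁ m₂ x hx h => exact two _ _ _ _ hx h
  · induction x, hx using odd_induction with
    | ι v =>
      have := mul 0 v 1 (SetLike.GradedOne.one_mem) (by simpa using alg 1)
      simpa using this
    | add x y hx hy h1 h2 => exact add _ _ _ h1 h2
    | ι_mul_ι_mul m₁ m₂ x hx h => exact two _ _ _ _ hx h

theorem ι_mul_mem {Q : QuadraticForm ℂ V} (m : V) {i : ZMod 2} {x : CliffordAlgebra Q}
    (hx : x ∈ evenOdd Q i) : ι Q m * x ∈ evenOdd Q (i + 1) := by
  rw [add_comm]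
  exact SetLike.mul_mem_graded (ι_mem_evenOdd_one Q m) hx

theorem add_one_one (i : ZMod 2) : i + 1 + 1 = i := by revert i; decide

theorem contractLeft_mem {Q : QuadraticForm ℂ V} (d : Module.Dual ℂ V) (i : ZMod 2)
    (x : CliffordAlgebra Q) (hx : x ∈ evenOdd Q i) : contractLeft d x ∈ evenOdd Q (i + 1) := by
  refine parity_induction (P := fun i x => contractLeft d x ∈ evenOdd Q (i + 1))
    ?_ ?_ ?_ i x hx
  · intro r; simp
  · intro i x y h1 h2; rw [map_add]; exact add_mem h1 h2
  · intro i m x hx h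
    rw [contractLeft_ι_mul]
    refine sub_mem ?_ (ι_mul_mem m h)
    rw [add_one_one]
    exact Submodule.smul_mem _ _ hx

theorem changeForm_mem {Q Q' : QuadraticForm ℂ V} {B : LinearMap.BilinForm ℂ V}
    (h : B.toQuadraticMap = Q' - Q) (i : ZMod 2)
    (x : CliffordAlgebra Q) (hx : x ∈ evenOdd Q i) : changeForm h x ∈ evenOdd Q' i := by
  refine parity_induction (P := fun i x => changeForm h x ∈ evenOdd Q' i)
    ?_ ?_ ?_ i x hx
  · intro r; rw [changeForm_algebraMap]; exact SetLike.algebraMap_mem_graded _ _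
  · intro i x y h1 h2; rw [map_add]; exact add_mem h1 h2
  · intro i m x hx h1
    rw [changeForm_ι_mul]
    exact sub_mem (ι_mul_mem m h1) (contractLeft_mem _ _ _ h1)

theorem map_mem {W : Type*} [AddCommGroup W] [Module ℂ W] {Q : QuadraticForm ℂ V}
    {Q' : QuadraticForm ℂ W} (f : Q →qᵢ Q') (i : ZMod 2)
    (x : CliffordAlgebra Q) (hx : x ∈ evenOdd Q i) : CliffordAlgebra.map f x ∈ evenOdd Q' i := by
  refine parity_induction (P := fun i x => CliffordAlgebra.map f x ∈ evenOdd Q' i)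
    ?_ ?_ ?_ i x hx
  · intro r; rw [AlgHom.commutes]; exact SetLike.algebraMap_mem_graded _ _
  · intro i x y h1 h2; rw [map_add]; exact add_mem h1 h2
  · intro i m x hx h1
    rw [map_mul, map_apply_ι]
    exact ι_mul_mem _ h1

/-- The span of `ι u * y` with `y` of parity `i + 1`. -/
def S (Q : QuadraticForm ℂ V) (U : Submodule ℂ V) (i : ZMod 2) :
    Submodule ℂ (CliffordAlgebra Q) :=
  Submodule.span ℂ {z | ∃ u ∈ U, ∃ y ∈ evenOdd Q (i + 1), z = ι Q u * y}

theorem S_le (Q : QuadraticForm ℂ V) (U : Submodule ℂ V) (i : ZMod 2) :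
    S Q U i ≤ evenOdd Q i := by
  refine Submodule.span_le.2 ?_
  rintro _ ⟨u, -, y, hy, rfl⟩
  have := ι_mul_mem u hy
  rwa [add_one_one] at this

theorem map_S_le {Q Q' : QuadraticForm ℂ V} {B : LinearMap.BilinForm ℂ V}
    (h : B.toQuadraticMap = Q' - Q) (U : Submodule ℂ V) (hB : ∀ u ∈ U, B u = 0) (i : ZMod 2) :
    (S Q U i).map (changeForm h) ≤ S Q' U i := by
  rw [S, Submodule.map_span_le]
  rintro _ ⟨u, hu, y, hy, rfl⟩
  rw [changeForm_ι_mul, hB u hu]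
  simp only [map_zero, LinearMap.zero_apply, sub_zero]
  exact Submodule.subset_span ⟨u, hu, _, changeForm_mem h _ _ hy, rfl⟩

theorem finrank_S_eq [FiniteDimensional ℂ V] {Q Q' : QuadraticForm ℂ V}
    {B : LinearMap.BilinForm ℂ V}
    (h : B.toQuadraticMap = Q' - Q) (U : Submodule ℂ V) (hB : ∀ u ∈ U, B u = 0) (i : ZMod 2) :
    Module.finrank ℂ (S Q U i) = Module.finrank ℂ (S Q' U i) := by
  have e : (S Q U i).map (changeFormEquiv h).toLinearMap = S Q' U i := by
    refine le_antisymm (map_S_le h U hB i) ?_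
    intro x hx
    refine ⟨(changeFormEquiv h).symm x, ?_, (changeFormEquiv h).apply_symm_apply x⟩
    rw [changeFormEquiv_symm]
    exact map_S_le (changeForm.neg_proof h) U (fun u hu => by simp [hB u hu]) i ⟨x, hx, rfl⟩
  rw [← e]
  exact ((changeFormEquiv h).finrank_map_eq _).symm

/-- the non-symmetric bilinear form -/
theorem exists_form (Q : QuadraticForm ℂ V) (U : Submodule ℂ V) (hU : ∀ u ∈ U, Q u = 0)
    (p : V →ₗ[ℂ] V) (hp : ∀ v, v - p v ∈ U) (hpU : ∀ u ∈ U, p u = 0) :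
    ∃ B : LinearMap.BilinForm ℂ V, B.toQuadraticMap = 0 - Q ∧ ∀ u ∈ U, B u = 0 := by
  refine ⟨-((QuadraticMap.associated (R := ℂ) Q).compl₁₂ p p
    + Q.polarBilin.compl₁₂ p (LinearMap.id - p)), ?_, ?_⟩
  · ext v
    have h1 : Q v = Q (p v) + Q (v - p v) + QuadraticMap.polar Q (p v) (v - p v) := by
      simp [QuadraticMap.polar]
    rw [hU _ (hp v)] at h1
    simp [h1, QuadraticMap.associated_eq_self_apply]
  · intro u hu
    ext v
    simp [hpU u hu]

theorem ι_mul_S {U : Submodule ℂ V} (m : V) {i : ZMod 2} {x : CliffordAlgebra (0 : QuadraticForm ℂ V)}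
    (hx : x ∈ S 0 U i) : ι 0 m * x ∈ S 0 U (i + 1) := by
  induction hx using Submodule.span_induction with
  | mem x hx =>
    obtain ⟨u, hu, y, hy, rfl⟩ := hx
    have : ι 0 m * (ι (0 : QuadraticForm ℂ V) u * y) = - (ι 0 u * (ι 0 m * y)) := by
      rw [← mul_assoc, ← mul_assoc, ← neg_mul]
      congr 1
      rw [eq_neg_iff_add_eq_zero, ι_mul_ι_add_swap]
      simp [QuadraticMap.polar]
    rw [this]
    exact neg_mem (Submodule.subset_span ⟨u, hu, _, ι_mul_mem m hy, rfl⟩)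
  | zero => simp
  | add x y _ _ h1 h2 => rw [mul_add]; exact add_mem h1 h2
  | smul a x _ h => rw [mul_smul_comm]; exact Submodule.smul_mem _ _ h

theorem map_sub_mem {U : Submodule ℂ V}
    (p : (0 : QuadraticForm ℂ V) →qᵢ (0 : QuadraticForm ℂ V)) (hp : ∀ v, v - p v ∈ U)
    (i : ZMod 2) (x : CliffordAlgebra (0 : QuadraticForm ℂ V)) (hx : x ∈ evenOdd 0 i) :
    x - CliffordAlgebra.map p x ∈ S 0 U i := by
  refine parity_induction (P := fun i x => x - CliffordAlgebra.map p x ∈ S 0 U i)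
    ?_ ?_ ?_ i x hx
  · intro r; simp
  · intro i x y h1 h2
    rw [map_add, add_sub_add_comm]; exact add_mem h1 h2
  · intro i m x hx h1
    have : ι 0 m * x - CliffordAlgebra.map p (ι 0 m * x)
        = ι 0 m * (x - CliffordAlgebra.map p x) + ι 0 (m - p m) * CliffordAlgebra.map p x := by
      rw [map_mul, map_apply_ι, map_sub]; noncomm_ring
    rw [this]
    refine add_mem (ι_mul_S m h1) (Submodule.subset_span ⟨_, hp m, _, ?_, rfl⟩)
    rw [add_one_one]
    exact map_mem p i x hx

instance finite0 [FiniteDimensional ℂ V] :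
    FiniteDimensional ℂ (CliffordAlgebra (0 : QuadraticForm ℂ V)) :=
  Module.Finite.of_basis (Module.finBasis ℂ V).ExteriorAlgebra

theorem finrank0 [FiniteDimensional ℂ V] :
    Module.finrank ℂ (CliffordAlgebra (0 : QuadraticForm ℂ V)) = 2 ^ Module.finrank ℂ V := by
  have := Module.finrank_eq_card_basis (Module.finBasis ℂ V).ExteriorAlgebra
  simpa using this

theorem finrank_even [FiniteDimensional ℂ V] (h : 0 < Module.finrank ℂ V) :
    Module.finrank ℂ (evenOdd (0 : QuadraticForm ℂ V) 0) = 2 ^ (Module.finrank ℂ V - 1) := by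
  have : Nontrivial V := Module.nontrivial_of_finrank_pos h
  obtain ⟨v, hv⟩ := exists_ne (0 : V)
  obtain ⟨d, hd⟩ := Module.Projective.exists_dual_eq_one ℂ hv
  let f : CliffordAlgebra (0 : QuadraticForm ℂ V) →ₗ[ℂ] CliffordAlgebra (0 : QuadraticForm ℂ V) :=
    LinearMap.mulLeft ℂ (ι 0 v) + contractLeft d
  have hf : ∀ x, f (f x) = x := by
    intro x
    simp [f, mul_add, contractLeft_ι_mul, hd, contractLeft_contractLeft, ← mul_assoc, ι_sq_scalar]
  have hm : ∀ i x, x ∈ evenOdd (0 : QuadraticForm ℂ V) i → f x ∈ evenOdd 0 (i + 1) :=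
    fun i x hx => add_mem (ι_mul_mem v hx) (contractLeft_mem d i x hx)
  let F : CliffordAlgebra (0 : QuadraticForm ℂ V) ≃ₗ[ℂ] CliffordAlgebra (0 : QuadraticForm ℂ V) :=
    LinearEquiv.ofInvolutive f hf
  have e : (evenOdd (0 : QuadraticForm ℂ V) 0).map F.toLinearMap = evenOdd 0 1 := by
    refine le_antisymm ?_ ?_
    · rintro _ ⟨x, hx, rfl⟩
      exact hm 0 x hx
    · intro x hx
      exact ⟨f x, hm 1 x hx, hf x⟩
  have e2 := F.finrank_map_eq (evenOdd (0 : QuadraticForm ℂ V) 0)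
  rw [e] at e2
  have e3 := Submodule.finrank_add_eq_of_isCompl (evenOdd_isCompl (0 : QuadraticForm ℂ V))
  rw [e2, finrank0] at e3
  obtain ⟨m, hm⟩ : ∃ m, Module.finrank ℂ V = m + 1 := ⟨_, (Nat.succ_pred_eq_of_pos h).symm⟩
  rw [hm, pow_succ] at e3
  rw [hm, Nat.add_sub_cancel]
  omega

theorem finrank_S0 [FiniteDimensional ℂ V] (U W : Submodule ℂ V)
    (proj : V →ₗ[ℂ] W) (hp : ∀ v, v - proj v ∈ U) (hpU : ∀ u ∈ U, proj u = 0)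
    (hpW : ∀ w : W, proj w = w) :
    Module.finrank ℂ (S 0 U 0) + Module.finrank ℂ (evenOdd (0 : QuadraticForm ℂ W) 0)
      = Module.finrank ℂ (evenOdd (0 : QuadraticForm ℂ V) 0) := by
  let P : (0 : QuadraticForm ℂ V) →qᵢ (0 : QuadraticForm ℂ W) := ⟨proj, by simp⟩
  let I : (0 : QuadraticForm ℂ W) →qᵢ (0 : QuadraticForm ℂ V) := ⟨W.subtype, by simp⟩
  have hPI : Function.LeftInverse (CliffordAlgebra.map P) (CliffordAlgebra.map I) :=
    leftInverse_map_of_leftInverse I P hpW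
  let E' := (evenOdd (0 : QuadraticForm ℂ W) 0).map (CliffordAlgebra.map I).toLinearMap
  have hE' : Module.finrank ℂ E' = Module.finrank ℂ (evenOdd (0 : QuadraticForm ℂ W) 0) :=
    (Submodule.equivMapOfInjective _ hPI.injective _).finrank_eq.symm
  have hsup : S 0 U 0 ⊔ E' = evenOdd (0 : QuadraticForm ℂ V) 0 := by
    refine le_antisymm (sup_le (S_le _ _ _) ?_) ?_
    · rintro _ ⟨x, hx, rfl⟩
      exact map_mem I 0 x hx
    · intro x hx
      have h1 := map_sub_mem (U := U) (I.comp P) hp 0 x hx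
      have h2 : CliffordAlgebra.map (I.comp P) x ∈ E' := by
        rw [← map_comp_map]
        exact ⟨_, map_mem P 0 x hx, rfl⟩
      have := Submodule.add_mem_sup h1 h2
      rwa [sub_add_cancel] at this
  have hinf : S 0 U 0 ⊓ E' = ⊥ := by
    rw [eq_bot_iff]
    rintro z ⟨hz, w, hw, rfl⟩
    have : S 0 U 0 ≤ LinearMap.ker (CliffordAlgebra.map P).toLinearMap := by
      refine Submodule.span_le.2 ?_
      rintro _ ⟨u, hu, y, hy, rfl⟩
      have : P u = 0 := hpU u hu
      simp [this]
    have h0 := this hz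
    have h1 : CliffordAlgebra.map P (CliffordAlgebra.map I w) = 0 := h0
    rw [hPI] at h1
    simp [h1]
  have := Submodule.finrank_sup_add_finrank_inf_eq (S 0 U 0) E'
  rw [hsup, hinf, hE'] at this
  simpa using this.symm

end IsoSpan

/-- For an `n`-dimensional quadratic space `(V, Q)` and a `k`-dimensional totally isotropic
subspace `U` with `k < n`, the span of `{ι(u)·y : u ∈ U, y ∈ Cl¹(Q)}` lies in the even part
`Cl⁰(Q)` and has dimension `(2^k - 1)·2^(n-k-1)`, independently of `Q` and `U`. -/
theorem finrank_isotropic_mul_odd_span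
    {V : Type*} [AddCommGroup V] [Module ℂ V] [FiniteDimensional ℂ V]
    (Q : QuadraticForm ℂ V) (n : ℕ) (hn : Module.finrank ℂ V = n)
    (U : Submodule ℂ V) (hU : ∀ u ∈ U, Q u = 0)
    (k : ℕ) (hk : Module.finrank ℂ U = k) (hkn : k < n) :
    Submodule.span ℂ
        {z : CliffordAlgebra Q | ∃ u ∈ U, ∃ y ∈ evenOdd Q 1, z = ι Q u * y}
      ≤ evenOdd Q 0 ∧
    Module.finrank ℂ
        (Submodule.span ℂ
          {z : CliffordAlgebra Q | ∃ u ∈ U, ∃ y ∈ evenOdd Q 1, z = ι Q u * y})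
      = (2 ^ k - 1) * 2 ^ (n - k - 1) := by
  have hS : Submodule.span ℂ {z : CliffordAlgebra Q | ∃ u ∈ U, ∃ y ∈ evenOdd Q 1, z = ι Q u * y}
      = IsoSpan.S Q U 0 := by
    simp [IsoSpan.S]
  rw [hS]
  refine ⟨IsoSpan.S_le Q U 0, ?_⟩
  obtain ⟨W, hW⟩ := U.exists_isCompl
  have hdim := Submodule.finrank_add_eq_of_isCompl hW
  let proj : V →ₗ[ℂ] W := W.projectionOnto U hW.symm
  have hpU : ∀ u ∈ U, proj u = 0 := fun u hu => by simpa [proj] using hu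
  have hpW : ∀ w : W, proj w = w := fun w => by simp [proj]
  have hp : ∀ v, v - proj v ∈ U := by
    intro v
    have : proj (v - proj v) = 0 := by rw [map_sub, hpW, sub_self]
    exact (Submodule.projectionOnto_apply_eq_zero_iff hW.symm).1 this
  obtain ⟨B, hB, hBU⟩ := IsoSpan.exists_form Q U hU (W.subtype ∘ₗ proj) hp
    (fun u hu => by simp [hpU u hu])
  rw [IsoSpan.finrank_S_eq hB U hBU 0]
  have key := IsoSpan.finrank_S0 U W proj hp hpU hpW
  rw [IsoSpan.finrank_even (by omega), IsoSpan.finrank_even (by omega), hn] at key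
  have hw : Module.finrank ℂ W - 1 = n - k - 1 := by omega
  have hn1 : n - 1 = k + (n - k - 1) := by omega
  rw [hw, hn1, pow_add] at key
  rw [Nat.sub_mul, one_mul]
  omega
end

section
/- Let Q be a quadratic form on a complex vector space V, let (e_i)_{i ∈ I} be a family of pairwise orthogonal vectors in V (polar(e_a, e_b) = 0 for a ≠ b), and let φ : Cl(Q) → Cl(Q) be a ℂ-linear map satisfying ι(e_a)·φ(ι(e_b)·x) = −ι(e_b)·φ(ι(e_a)·x) for all indices a ≠ b and all x ∈ Cl(Q). Suppose i ≠ j are indices such that there exists an index m with m ≠ i, m ≠ j, and Q(e_m) = 1. Then ι(e_i)·ι(e_j)·φ(x) = φ(ι(e_i)·ι(e_j)·x) for all x ∈ Cl(Q). -/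
open CliffordAlgebra

/-- If `φ` satisfies the antisymmetry relations `ι(e_a)·φ(ι(e_b)·x) = −ι(e_b)·φ(ι(e_a)·x)`
for pairwise orthogonal vectors `(e_i)`, and `i ≠ j` admit a third index `m` with
`Q(e_m) = 1`, then `φ` commutes with left multiplication by `ι(e_i)·ι(e_j)`. -/
theorem clifford_degree_two_commutation
    {V : Type*} [AddCommGroup V] [Module ℂ V]
    (Q : QuadraticForm ℂ V) {I : Type*} (e : I → V)
    (he : ∀ a b, a ≠ b → QuadraticMap.polar Q (e a) (e b) = 0)
    (φ : CliffordAlgebra Q →ₗ[ℂ] CliffordAlgebra Q)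
    (hφ : ∀ a b, a ≠ b → ∀ x : CliffordAlgebra Q,
      ι Q (e a) * φ (ι Q (e b) * x) = -(ι Q (e b) * φ (ι Q (e a) * x)))
    (i j : I) (hij : i ≠ j)
    (m : I) (hmi : m ≠ i) (hmj : m ≠ j) (hm : Q (e m) = 1) :
    ∀ x : CliffordAlgebra Q,
      ι Q (e i) * ι Q (e j) * φ x = φ (ι Q (e i) * ι Q (e j) * x) := by
  have hmm : ∀ y : CliffordAlgebra Q, ι Q (e m) * (ι Q (e m) * y) = y := by
    intro y
    rw [← mul_assoc, ι_sq_scalar, hm, map_one, one_mul]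
  have anti : ∀ k, m ≠ k → ∀ y : CliffordAlgebra Q,
      ι Q (e m) * (ι Q (e k) * y) = -(ι Q (e k) * (ι Q (e m) * y)) := by
    intro k hk y
    have h := ι_mul_ι_add_swap (Q := Q) (e m) (e k)
    rw [he m k hk, map_zero] at h
    rw [← mul_assoc, eq_neg_of_add_eq_zero_left h, neg_mul, mul_assoc]
  have key : ∀ k, m ≠ k → ∀ y : CliffordAlgebra Q,
      φ (ι Q (e k) * y) = ι Q (e k) * (ι Q (e m) * φ (ι Q (e m) * y)) := by
    intro k hk y
    have h := congrArg (fun z => ι Q (e m) * z) (hφ m k hk y)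
    simp only [mul_neg] at h
    rw [hmm, anti k hk, neg_neg] at h
    exact h
  intro x
  rw [mul_assoc, mul_assoc, key i hmi, anti j hmj, map_neg, key j hmj, hmm, mul_neg, mul_neg,
    anti j hmj, hmm, mul_neg, neg_neg]
end

section
/- Let Q be a quadratic form on a complex vector space V, let n ≥ 2, and let e₁, …, e_n ∈ V be pairwise orthogonal vectors (polar(e_a, e_b) = 0 for a ≠ b) with Q(e₁) = Q(e₂) = 1; write λ_i = Q(e_i). Suppose φ₁, …, φ_n, ψ₁, …, ψ_n, α : Cl(Q) → Cl(Q) are ℂ-linear maps such that for all x ∈ Cl(Q): (i) ι(e_j)·φ_i(x) + ι(e_i)·φ_j(x) = 0 for all i ≠ j; (ii) ι(e_i)·φ_i(x) = λ_i·α(x) for all i; (iii) φ_i(ι(e_j)·x) = ι(e_i)·ψ_j(x) for all i ≠ j. Then for all i and all x ∈ Cl(Q): φ_i(x) = ι(e_i)·α(x) and ψ_i(x) = α(ι(e_i)·x). -/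
open CliffordAlgebra

/-- Fiberwise exactness `im(d₀) = ker(d₁)`: given pairwise orthogonal vectors `e₁, …, e_n`
(two of which have square 1) and linear maps `φ_i, ψ_i, α` on `Cl(Q)` satisfying
(i) `e_j·φ_i + e_i·φ_j = 0` for `i ≠ j`, (ii) `e_i·φ_i = λ_i·α`, and
(iii) `φ_i(e_j·x) = e_i·ψ_j(x)` for `i ≠ j`, one has `φ_i = e_i·α` and `ψ_i = α(e_i·–)`. -/
theorem clifford_ker_d1_eq_im_d0
    {V : Type*} [AddCommGroup V] [Module ℂ V]
    (Q : QuadraticForm ℂ V) {n : ℕ} (e : Fin n → V)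
    (he : ∀ i j, i ≠ j → QuadraticMap.polar Q (e i) (e j) = 0)
    (a b : Fin n) (hab : a ≠ b) (ha : Q (e a) = 1) (hb : Q (e b) = 1)
    (φ ψ : Fin n → CliffordAlgebra Q →ₗ[ℂ] CliffordAlgebra Q)
    (α : CliffordAlgebra Q →ₗ[ℂ] CliffordAlgebra Q)
    (h1 : ∀ i j, i ≠ j → ∀ x : CliffordAlgebra Q,
      ι Q (e j) * φ i x + ι Q (e i) * φ j x = 0)
    (h2 : ∀ i, ∀ x : CliffordAlgebra Q, ι Q (e i) * φ i x = Q (e i) • α x)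
    (h3 : ∀ i j, i ≠ j → ∀ x : CliffordAlgebra Q,
      φ i (ι Q (e j) * x) = ι Q (e i) * ψ j x) :
    ∀ i, ∀ x : CliffordAlgebra Q,
      φ i x = ι Q (e i) * α x ∧ ψ i x = α (ι Q (e i) * x) := by
  have sq : ∀ c, Q (e c) = 1 → ∀ y z : CliffordAlgebra Q,
      ι Q (e c) * y = ι Q (e c) * z → y = z := by
    intro c hc y z h
    have h' := congrArg (fun t => ι Q (e c) * t) h
    simpa only [← mul_assoc, ι_sq_scalar, hc, map_one, one_mul] using h'
  have anti : ∀ i j, i ≠ j → ι Q (e i) * ι Q (e j) = - (ι Q (e j) * ι Q (e i)) := by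
    intro i j hij
    have h := ι_mul_ι_add_swap (Q := Q) (e i) (e j)
    rw [he i j hij, map_zero] at h
    exact eq_neg_of_add_eq_zero_left h
  have hφa : ∀ x, φ a x = ι Q (e a) * α x := by
    intro x
    apply sq a ha
    rw [h2, ← mul_assoc, ι_sq_scalar, ha, map_one, one_mul, one_smul]
  have hφ : ∀ i x, φ i x = ι Q (e i) * α x := by
    intro i x
    by_cases hi : i = a
    · rw [hi]; exact hφa x
    · apply sq a ha
      rw [eq_neg_of_add_eq_zero_left (h1 i a hi x), hφa, ← mul_assoc, ← mul_assoc,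
        anti i a hi, neg_mul, neg_neg]
  intro i x
  refine ⟨hφ i x, ?_⟩
  by_cases hi : a = i
  · have hbi : b ≠ i := fun h => hab (hi.trans h.symm)
    apply sq b hb
    rw [← h3 b i hbi, hφ]
  · apply sq a ha
    rw [← h3 a i hi, hφ]
end

section
/- Let Q be a quadratic form on a complex vector space V, let e₁, …, e_n ∈ V be pairwise orthogonal vectors (polar(e_a, e_b) = 0 for a ≠ b) with Q(e_a) = 1 for some index a; write λ_i = Q(e_i). Suppose φ_{ij} (1 ≤ i, j ≤ n) and α_j (1 ≤ j ≤ n) are ℂ-linear maps Cl(Q) → Cl(Q) with φ_{ij} = φ_{ji}, such that for all x ∈ Cl(Q): (i) ι(e_k)·φ_{ij}(x) + ι(e_j)·φ_{ik}(x) + ι(e_i)·φ_{jk}(x) = 0 for all pairwise distinct i, j, k; (ii) ι(e_j)·φ_{ii}(x) + ι(e_i)·φ_{ij}(x) = λ_i·α_j(x) for all i ≠ j; (iii) ι(e_i)·φ_{ii}(x) = λ_i·α_i(x) for all i. Then φ_{ij}(x) = ι(e_i)·α_j(x) + ι(e_j)·α_i(x) for all i ≠ j and φ_{ii}(x) = ι(e_i)·α_i(x)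 for all i. -/
open CliffordAlgebra

/-- First-component derivation in `im(d₁) = ker(d₂)`: given pairwise orthogonal vectors and
symmetric families `φ_{ij}` with (i) `e_k·φ_{ij} + e_j·φ_{ik} + e_i·φ_{jk} = 0`,
(ii) `e_j·φ_{ii} + e_i·φ_{ij} = λ_i·α_j`, (iii) `e_i·φ_{ii} = λ_i·α_i`, one concludes
`φ_{ij} = e_i·α_j + e_j·α_i` and `φ_{ii} = e_i·α_i`. -/
theorem clifford_ker_d2_first_component
    {V : Type*} [AddCommGroup V] [Module ℂ V]
    (Q : QuadraticForm ℂ V) {n : ℕ} (e : Fin n → V)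
    (he : ∀ i j, i ≠ j → QuadraticMap.polar Q (e i) (e j) = 0)
    (a : Fin n) (ha : Q (e a) = 1)
    (φ : Fin n → Fin n → CliffordAlgebra Q →ₗ[ℂ] CliffordAlgebra Q)
    (α : Fin n → CliffordAlgebra Q →ₗ[ℂ] CliffordAlgebra Q)
    (hsymm : ∀ i j, φ i j = φ j i)
    (h1 : ∀ i j k, i ≠ j → i ≠ k → j ≠ k → ∀ x : CliffordAlgebra Q,
      ι Q (e k) * φ i j x + ι Q (e j) * φ i k x + ι Q (e i) * φ j k x = 0)
    (h2 : ∀ i j, i ≠ j → ∀ x : CliffordAlgebra Q,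
      ι Q (e j) * φ i i x + ι Q (e i) * φ i j x = Q (e i) • α j x)
    (h3 : ∀ i, ∀ x : CliffordAlgebra Q,
      ι Q (e i) * φ i i x = Q (e i) • α i x) :
    (∀ i j, i ≠ j → ∀ x : CliffordAlgebra Q,
      φ i j x = ι Q (e i) * α j x + ι Q (e j) * α i x) ∧
    (∀ i, ∀ x : CliffordAlgebra Q, φ i i x = ι Q (e i) * α i x) := by
  have sq : ∀ i (y : CliffordAlgebra Q), ι Q (e i) * (ι Q (e i) * y) = Q (e i) • y := by
    intro i y
    rw [← mul_assoc, ι_sq_scalar, Algebra.smul_def]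
  have anti : ∀ i j, i ≠ j → ∀ y : CliffordAlgebra Q,
      ι Q (e i) * (ι Q (e j) * y) = -(ι Q (e j) * (ι Q (e i) * y)) := by
    intro i j hij y
    have h := ι_mul_ι_add_swap (Q := Q) (e i) (e j)
    rw [he i j hij, map_zero] at h
    rw [← mul_assoc, ← mul_assoc, eq_neg_of_add_eq_zero_left h, neg_mul]
  have sqa : ∀ y : CliffordAlgebra Q, ι Q (e a) * (ι Q (e a) * y) = y := by
    intro y
    rw [sq, ha, one_smul]
  have cancel : ∀ u v : CliffordAlgebra Q, ι Q (e a) * u = ι Q (e a) * v → u = v := by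
    intro u v h
    rw [← sqa u, h, sqa]
  have haa : ∀ x, φ a a x = ι Q (e a) * α a x := by
    intro x
    apply cancel
    rw [h3, sqa, ha, one_smul]
  have haj : ∀ j, a ≠ j → ∀ x, φ a j x = ι Q (e a) * α j x + ι Q (e j) * α a x := by
    intro j hj x
    apply cancel
    have h := h2 a j hj x
    rw [ha, one_smul, haa] at h
    rw [mul_add, sqa, anti a j hj, ← h]
    abel
  have hii : ∀ i, ∀ x, φ i i x = ι Q (e i) * α i x := by
    intro i x
    by_cases hi : a = i
    · subst hi
      exact haa x
    apply cancel
    have h := h2 i a (Ne.symm hi) x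
    rw [hsymm i a, haj i hi, mul_add, sq] at h
    rw [anti a i hi, eq_neg_iff_add_eq_zero]
    rw [← add_assoc] at h
    exact add_eq_right.mp h
  refine ⟨?_, hii⟩
  intro i j hij x
  by_cases hi : a = i
  · subst hi
    exact haj j hij x
  by_cases hj : a = j
  · subst hj
    rw [hsymm, haj i hi, add_comm]
  apply cancel
  have h := h1 i j a hij (Ne.symm hi) (Ne.symm hj) x
  rw [hsymm i a, hsymm j a, haj i hi, haj j hj, mul_add, mul_add, anti j i (Ne.symm hij)] at h
  rw [mul_add, anti a i hi, anti a j hj, ← sub_eq_zero, ← h]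
  abel
end

section
/- Let Q be a quadratic form on a complex vector space V, let e₁, …, e_n ∈ V be pairwise orthogonal vectors (polar(e_b, e_c) = 0 for b ≠ c) with Q(e_a) = 1 for a fixed index a; write λ_i = Q(e_i). Suppose α_j, γ_j (1 ≤ j ≤ n), δ, and ψ_{ij} (1 ≤ i, j ≤ n) are ℂ-linear maps Cl(Q) → Cl(Q) such that, writing Φ_{ij}(x) = ι(e_i)·α_j(x) + ι(e_j)·α_i(x) for i ≠ j and Φ_{ii}(x) = ι(e_i)·α_i(x), the following hold for all x ∈ Cl(Q): (h1) Φ_{aa}(ι(e_i)·x) − ι(e_a)·ψ_{ia}(x) = γ_i(x) for all i ≠ a; (h2) Φ_{aj}(ι(e_i)·x) − ι(e_a)·ψ_{ij}(x) − ι(e_j)·ψ_{ia}(x) = 0 for all i, j, a pairwise distinct; (h3) Φ_{ai}(ι(e_i)·x) − ι(e_i)·ψ_{ia}(x) − ι(e_a)·ψ_{ii}(x) = λ_i·δ(x) for all i ≠ a; (h4) Φ_{aa}(ι(e_a)·x) − ι(e_a)·ψ_{aa}(x) = γ_a(x) + δ(x). Then for all x ∈ Cl(Q): ψ_{ia}(x)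 = α_a(ι(e_i)·x) − ι(e_a)·γ_i(x) for i ≠ a; ψ_{ij}(x) = α_j(ι(e_i)·x) − ι(e_j)·γ_i(x) for i, j, a pairwise distinct; ψ_{ii}(x) = α_i(ι(e_i)·x) − ι(e_i)·γ_i(x) − λ_i·ι(e_a)·δ(x) for i ≠ a; and ψ_{aa}(x) = α_a(ι(e_a)·x) − ι(e_a)·γ_a(x) − ι(e_a)·δ(x). -/
open CliffordAlgebra

/-- Second-component derivation in `im(d₁) = ker(d₂)`: the relations (h1)–(h4), where
`Φ_{ij} = ι(e_i)·α_j + ι(e_j)·α_i` (and `Φ_{ii} = ι(e_i)·α_i`), determine the maps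
`ψ_{ij}` in terms of `α`, `γ` and `δ`. -/
theorem clifford_ker_d2_second_component
    {V : Type*} [AddCommGroup V] [Module ℂ V]
    (Q : QuadraticForm ℂ V) {n : ℕ} (e : Fin n → V)
    (he : ∀ b c, b ≠ c → QuadraticMap.polar Q (e b) (e c) = 0)
    (a : Fin n) (ha : Q (e a) = 1)
    (α γ : Fin n → CliffordAlgebra Q →ₗ[ℂ] CliffordAlgebra Q)
    (δ : CliffordAlgebra Q →ₗ[ℂ] CliffordAlgebra Q)
    (ψ : Fin n → Fin n → CliffordAlgebra Q →ₗ[ℂ] CliffordAlgebra Q)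
    (h1 : ∀ i, i ≠ a → ∀ x : CliffordAlgebra Q,
      ι Q (e a) * α a (ι Q (e i) * x) - ι Q (e a) * ψ i a x = γ i x)
    (h2 : ∀ i j, i ≠ j → i ≠ a → j ≠ a → ∀ x : CliffordAlgebra Q,
      (ι Q (e a) * α j (ι Q (e i) * x) + ι Q (e j) * α a (ι Q (e i) * x))
        - ι Q (e a) * ψ i j x - ι Q (e j) * ψ i a x = 0)
    (h3 : ∀ i, i ≠ a → ∀ x : CliffordAlgebra Q,
      (ι Q (e a) * α i (ι Q (e i) * x) + ι Q (e i) * α a (ι Q (e i) * x))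
        - ι Q (e i) * ψ i a x - ι Q (e a) * ψ i i x = Q (e i) • δ x)
    (h4 : ∀ x : CliffordAlgebra Q,
      ι Q (e a) * α a (ι Q (e a) * x) - ι Q (e a) * ψ a a x = γ a x + δ x) :
    (∀ i, i ≠ a → ∀ x : CliffordAlgebra Q,
      ψ i a x = α a (ι Q (e i) * x) - ι Q (e a) * γ i x) ∧
    (∀ i j, i ≠ j → i ≠ a → j ≠ a → ∀ x : CliffordAlgebra Q,
      ψ i j x = α j (ι Q (e i) * x) - ι Q (e j) * γ i x) ∧
    (∀ i, i ≠ a → ∀ x : CliffordAlgebra Q,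
      ψ i i x = α i (ι Q (e i) * x) - ι Q (e i) * γ i x - Q (e i) • (ι Q (e a) * δ x)) ∧
    (∀ x : CliffordAlgebra Q,
      ψ a a x = α a (ι Q (e a) * x) - ι Q (e a) * γ a x - ι Q (e a) * δ x) := by
  have sq : ∀ y : CliffordAlgebra Q, ι Q (e a) * (ι Q (e a) * y) = y := by
    intro y
    rw [← mul_assoc, ι_sq_scalar, ha, map_one, one_mul]
  have key : ∀ u w : CliffordAlgebra Q, ι Q (e a) * u = w → u = ι Q (e a) * w := by
    intro u w h
    rw [← h, sq]
  have anti : ∀ j, j ≠ a → ∀ y : CliffordAlgebra Q,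
      ι Q (e j) * (ι Q (e a) * y) = -(ι Q (e a) * (ι Q (e j) * y)) := by
    intro j hj y
    have h := ι_mul_ι_add_swap (Q := Q) (e j) (e a)
    rw [he j a hj, map_zero] at h
    rw [← mul_assoc, eq_neg_of_add_eq_zero_left h, neg_mul, mul_assoc]
  have r1 : ∀ i, i ≠ a → ∀ x : CliffordAlgebra Q,
      α a (ι Q (e i) * x) - ψ i a x = ι Q (e a) * γ i x := by
    intro i hi x
    apply key
    rw [mul_sub, h1 i hi x]
  have r2 : ∀ i j, i ≠ a → j ≠ a → ∀ x : CliffordAlgebra Q,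
      ι Q (e j) * α a (ι Q (e i) * x) - ι Q (e j) * ψ i a x
        = -(ι Q (e a) * (ι Q (e j) * γ i x)) := by
    intro i j hi hj x
    rw [← mul_sub, r1 i hi x, anti j hj]
  refine ⟨?_, ?_, ?_, ?_⟩
  · intro i hi x
    rw [← r1 i hi x, sub_sub_cancel]
  · intro i j hij hi hj x
    have h : α j (ι Q (e i) * x) - ψ i j x = ι Q (e a) * (ι Q (e a) * (ι Q (e j) * γ i x)) := by
      apply key
      rw [mul_sub, ← sub_eq_zero, ← h2 i j hij hi hj x,
        ← neg_eq_iff_eq_neg.mpr (r2 i j hi hj x)]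
      abel
    rw [sq] at h
    rw [← h, sub_sub_cancel]
  · intro i hi x
    have h : α i (ι Q (e i) * x) - ψ i i x
        = ι Q (e a) * (ι Q (e a) * (ι Q (e i) * γ i x) + Q (e i) • δ x) := by
      apply key
      rw [mul_sub, ← h3 i hi x, ← neg_eq_iff_eq_neg.mpr (r2 i i hi hi x)]
      abel
    rw [mul_add, sq, mul_smul_comm] at h
    rw [sub_sub, ← h, sub_sub_cancel]
  · intro x
    have h : α a (ι Q (e a) * x) - ψ a a x = ι Q (e a) * (γ a x + δ x) := by
      apply key
      rw [mul_sub, h4 x]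
    rw [mul_add] at h
    rw [sub_sub, ← h, sub_sub_cancel]
end

section
/- Let Q be a quadratic form on a complex vector space V, let e₁, …, e_n ∈ V be pairwise orthogonal vectors (polar(e_b, e_c) = 0 for b ≠ c) with Q(e_a) = 1 for some index a; write λ_i = Q(e_i). Suppose χ_{ij} (1 ≤ i, j ≤ n) and β_j (1 ≤ j ≤ n) are ℂ-linear maps Cl(Q) → Cl(Q) with χ_{ij} = χ_{ji}, such that for all x ∈ Cl(Q): (i) χ_{ij}(ι(e_k)·x) + χ_{ik}(ι(e_j)·x) + χ_{jk}(ι(e_i)·x) = 0 for all pairwise distinct i, j, k; (ii) χ_{ii}(ι(e_j)·x) + χ_{ij}(ι(e_i)·x) = λ_i·β_j(x) for all i ≠ j; (iii) χ_{ii}(ι(e_i)·x) = λ_i·β_i(x) for all i. Then χ_{ij}(x) = β_i(ι(e_j)·x) + β_j(ι(e_i)·x) for all i ≠ j and χ_{ii}(x) = β_i(ι(e_i)·x) for all i. -/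
open CliffordAlgebra

/-- Fourth-component derivation in `im(d₁) = ker(d₂)` (mirror of the first): given pairwise
orthogonal vectors and symmetric families `χ_{ij}` satisfying
(i) `χ_{ij}(e_k·x) + χ_{ik}(e_j·x) + χ_{jk}(e_i·x) = 0`,
(ii) `χ_{ii}(e_j·x) + χ_{ij}(e_i·x) = λ_i·β_j(x)`, (iii) `χ_{ii}(e_i·x) = λ_i·β_i(x)`,
one concludes `χ_{ij}(x) = β_i(e_j·x) + β_j(e_i·x)` and `χ_{ii}(x) = β_i(e_i·x)`. -/
theorem clifford_ker_d2_fourth_component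
    {V : Type*} [AddCommGroup V] [Module ℂ V]
    (Q : QuadraticForm ℂ V) {n : ℕ} (e : Fin n → V)
    (he : ∀ b c, b ≠ c → QuadraticMap.polar Q (e b) (e c) = 0)
    (a : Fin n) (ha : Q (e a) = 1)
    (χ : Fin n → Fin n → CliffordAlgebra Q →ₗ[ℂ] CliffordAlgebra Q)
    (β : Fin n → CliffordAlgebra Q →ₗ[ℂ] CliffordAlgebra Q)
    (hsymm : ∀ i j, χ i j = χ j i)
    (h1 : ∀ i j k, i ≠ j → i ≠ k → j ≠ k → ∀ x : CliffordAlgebra Q,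
      χ i j (ι Q (e k) * x) + χ i k (ι Q (e j) * x) + χ j k (ι Q (e i) * x) = 0)
    (h2 : ∀ i j, i ≠ j → ∀ x : CliffordAlgebra Q,
      χ i i (ι Q (e j) * x) + χ i j (ι Q (e i) * x) = Q (e i) • β j x)
    (h3 : ∀ i, ∀ x : CliffordAlgebra Q,
      χ i i (ι Q (e i) * x) = Q (e i) • β i x) :
    (∀ i j, i ≠ j → ∀ x : CliffordAlgebra Q,
      χ i j x = β i (ι Q (e j) * x) + β j (ι Q (e i) * x)) ∧
    (∀ i, ∀ x : CliffordAlgebra Q, χ i i x = β i (ι Q (e i) * x)) := by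
  have sq : ∀ i (x : CliffordAlgebra Q), ι Q (e i) * (ι Q (e i) * x) = Q (e i) • x := by
    intro i x
    rw [← mul_assoc, ι_sq_scalar, Algebra.smul_def]
  have sqa : ∀ x : CliffordAlgebra Q, ι Q (e a) * (ι Q (e a) * x) = x := by
    intro x
    rw [sq, ha, one_smul]
  have anti : ∀ i j, i ≠ j → ∀ x : CliffordAlgebra Q,
      ι Q (e i) * (ι Q (e j) * x) = -(ι Q (e j) * (ι Q (e i) * x)) := by
    intro i j hij x
    have h := ι_mul_ι_add_swap (Q := Q) (e i) (e j)
    rw [he i j hij, map_zero] at h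
    rw [← mul_assoc, eq_neg_of_add_eq_zero_left h, neg_mul, mul_assoc]
  have haa : ∀ x : CliffordAlgebra Q, χ a a x = β a (ι Q (e a) * x) := by
    intro x
    have h := h3 a (ι Q (e a) * x)
    rwa [sqa, ha, one_smul] at h
  have haj : ∀ j, a ≠ j → ∀ x : CliffordAlgebra Q,
      χ a j x = β a (ι Q (e j) * x) + β j (ι Q (e a) * x) := by
    intro j hj x
    have h := h2 a j hj (ι Q (e a) * x)
    rw [sqa, ha, one_smul, haa, anti j a hj.symm, mul_neg, sqa, map_neg] at h
    rw [← h]; abel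
  refine ⟨?_, ?_⟩
  · intro i j hij x
    by_cases hi : a = i
    · subst hi; exact haj j hij x
    by_cases hj : a = j
    · subst hj
      rw [hsymm, haj i hi, add_comm]
    have h := h1 i j a hij (Ne.symm hi) (Ne.symm hj) (ι Q (e a) * x)
    rw [sqa, hsymm i a, hsymm j a, haj i hi, haj j hj, anti a j hj, anti a i hi,
      anti i j hij, sqa] at h
    simp only [map_neg] at h
    rw [← sub_eq_zero, ← h]; abel
  · intro j x
    by_cases hj : a = j
    · subst hj; exact haa x
    have h := h2 j a (Ne.symm hj) (ι Q (e a) * x)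
    rw [sqa, hsymm j a, haj j hj, sq, anti a j hj, sqa, map_neg, map_smul] at h
    rw [← sub_eq_zero, ← sub_eq_zero.mpr h]; abel
end

section
/- Let α be a type with decidable equality, let P be a finite set of unordered pairs of elements of α (i.e. a finite subset of Sym²(α)), and let x, y ∈ α with x ≠ y. For an unordered pair p and z ∈ α define the multiplicity m_z(p) to be 2 if p is the diagonal pair {z, z}, 1 if z ∈ p and p is not the diagonal pair {z, z}, and 0 if z ∉ p. Then Σ_{p ∈ P} (m_x(p) + m_y(p)) ≤ |P| + 3. -/
/-- The multiplicity of `z` in an unordered pair `p`: `2` if `p` is the diagonal pair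
`{z, z}`, `1` if `z ∈ p` and `p` is not diagonal at `z`, and `0` otherwise. -/
def sym2Mult {α : Type*} [DecidableEq α] (z : α) (p : Sym2 α) : ℕ :=
  if p = Sym2.diag z then 2 else if z ∈ p then 1 else 0

/-- For any finite set `P` of unordered pairs and distinct `x ≠ y`, the combined total
multiplicity of `x` and `y` among the pairs of `P` is at most `|P| + 3`. -/
theorem sum_sym2Mult_add_le_card_add_three
    {α : Type*} [DecidableEq α] (P : Finset (Sym2 α)) (x y : α) (hxy : x ≠ y) :
    ∑ p ∈ P, (sym2Mult x p + sym2Mult y p) ≤ P.card + 3 := by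
  have key : ∀ p : Sym2 α, sym2Mult x p + sym2Mult y p ≤
      1 + ((if p = Sym2.diag x then 1 else 0) + (if p = Sym2.diag y then 1 else 0)
        + (if p = s(x, y) then 1 else 0)) := by
    intro p
    induction p using Sym2.ind with
    | _ a b =>
      simp only [sym2Mult, Sym2.diag, Sym2.mem_iff, Sym2.eq_iff]
      grind
  have one : ∀ q : Sym2 α, ∑ p ∈ P, (if p = q then 1 else 0) ≤ 1 := by
    intro q
    rw [Finset.sum_ite_eq']
    split_ifs <;> simp
  refine (Finset.sum_le_sum fun p _ => key p).trans ?_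
  simp only [Finset.sum_add_distrib]
  have h1 := one (Sym2.diag x)
  have h2 := one (Sym2.diag y)
  have h3 := one s(x, y)
  have h4 : ∑ p ∈ P, 1 = P.card := by simp
  omega
end
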